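/- arXiv:1012.5448 — 4 statements merged into one kernel-verified Lean document; each statement's English description precedes it below -/
import Mathlib

section
/- Let (u, ρ) be a smooth periodic solution on [0,T) of the periodic two-component Hunter–Saxton system with parameter k ∈ {1,-1}. Then the quantity a(t) = −(1/2)·∫₀¹ ( k·ρ(t,x)² + u_x(t,x)² ) dx is independent of t; i.e., for all t ∈ [0,T), ∫₀¹ ( k·ρ(t,x)² + u_x(t,x)² ) dx = ∫₀¹ ( k·ρ(0,x)² + u_x(0,x)² ) dx. -/
open Real Set MeasureTheory intervalIntegral

/-- Partial derivative in the space variable (second argument). -/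
noncomputable def pdx (f : ℝ → ℝ → ℝ) : ℝ → ℝ → ℝ := fun t x => deriv (f t) x

/-- Partial derivative in the time variable (first argument). -/
noncomputable def pdt (f : ℝ → ℝ → ℝ) : ℝ → ℝ → ℝ := fun t x => deriv (fun s => f s x) t

theorem hasDerivAt_space_fderiv {f : ℝ → ℝ → ℝ} (hf : ContDiff ℝ (⊤ : ℕ∞) (Function.uncurry f)) (t x : ℝ) :
    HasDerivAt (f t) (fderiv ℝ (Function.uncurry f) (t, x) (0, 1)) x := by
  have h := (hf.differentiable (by simp) (t, x)).hasFDerivAt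
  exact h.comp_hasDerivAt x ((hasDerivAt_const x t).prodMk (hasDerivAt_id x))

theorem hasDerivAt_time_fderiv {f : ℝ → ℝ → ℝ} (hf : ContDiff ℝ (⊤ : ℕ∞) (Function.uncurry f)) (t x : ℝ) :
    HasDerivAt (fun s => f s x) (fderiv ℝ (Function.uncurry f) (t, x) (1, 0)) t := by
  have h := (hf.differentiable (by simp) (t, x)).hasFDerivAt
  exact h.comp_hasDerivAt t ((hasDerivAt_id t).prodMk (hasDerivAt_const t x))

theorem uncurry_pdx {f : ℝ → ℝ → ℝ} (hf : ContDiff ℝ (⊤ : ℕ∞) (Function.uncurry f)) :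
    Function.uncurry (pdx f) = fun p => fderiv ℝ (Function.uncurry f) p (0, 1) :=
  funext fun p => (hasDerivAt_space_fderiv hf p.1 p.2).deriv

theorem uncurry_pdt {f : ℝ → ℝ → ℝ} (hf : ContDiff ℝ (⊤ : ℕ∞) (Function.uncurry f)) :
    Function.uncurry (pdt f) = fun p => fderiv ℝ (Function.uncurry f) p (1, 0) :=
  funext fun p => (hasDerivAt_time_fderiv hf p.1 p.2).deriv

theorem hasDerivAt_pdx {f : ℝ → ℝ → ℝ} (hf : ContDiff ℝ (⊤ : ℕ∞) (Function.uncurry f))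
    (t x : ℝ) : HasDerivAt (f t) (pdx f t x) x :=
  (hasDerivAt_space_fderiv hf t x).differentiableAt.hasDerivAt

theorem hasDerivAt_pdt {f : ℝ → ℝ → ℝ} (hf : ContDiff ℝ (⊤ : ℕ∞) (Function.uncurry f))
    (t x : ℝ) : HasDerivAt (fun s => f s x) (pdt f t x) t :=
  (hasDerivAt_time_fderiv hf t x).differentiableAt.hasDerivAt

theorem contDiff_pdx {f : ℝ → ℝ → ℝ} (hf : ContDiff ℝ (⊤ : ℕ∞) (Function.uncurry f)) :
    ContDiff ℝ (⊤ : ℕ∞) (Function.uncurry (pdx f)) := by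
  rw [uncurry_pdx hf]
  exact (hf.fderiv_right (by simp)).clm_apply contDiff_const

theorem contDiff_pdt {f : ℝ → ℝ → ℝ} (hf : ContDiff ℝ (⊤ : ℕ∞) (Function.uncurry f)) :
    ContDiff ℝ (⊤ : ℕ∞) (Function.uncurry (pdt f)) := by
  rw [uncurry_pdt hf]
  exact (hf.fderiv_right (by simp)).clm_apply contDiff_const

theorem pdx_pdt_comm {f : ℝ → ℝ → ℝ} (hf : ContDiff ℝ (⊤ : ℕ∞) (Function.uncurry f))
    (t x : ℝ) : pdx (pdt f) t x = pdt (pdx f) t x := by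
  have hd : DifferentiableAt ℝ (fderiv ℝ (Function.uncurry f)) (t, x) :=
    (hf.fderiv_right (m := (⊤ : ℕ∞)) (by simp)).differentiable (by simp) _
  have hsymm : IsSymmSndFDerivAt ℝ (Function.uncurry f) (t, x) :=
    hf.contDiffAt.isSymmSndFDerivAt <| by
      rw [minSmoothness_of_isRCLikeNormedField]
      exact WithTop.coe_le_coe.mpr (le_top (a := (2 : ℕ∞)))
  have h1 : pdx (pdt f) t x = _ := (hasDerivAt_space_fderiv (contDiff_pdt hf) t x).deriv
  have h2 : pdt (pdx f) t x = _ := (hasDerivAt_time_fderiv (contDiff_pdx hf) t x).deriv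
  rw [h1, h2, uncurry_pdt hf, uncurry_pdx hf, fderiv_clm_apply hd (by fun_prop),
    fderiv_clm_apply hd (by fun_prop)]
  simpa using hsymm (0, 1) (1, 0)

theorem pdx_periodic {f : ℝ → ℝ → ℝ} (hf : ∀ t x : ℝ, f t (x + 1) = f t x) (t x : ℝ) :
    pdx f t (x + 1) = pdx f t x := by
  unfold pdx
  rw [← deriv_comp_add_const, funext (hf t)]

theorem pdt_periodic {f : ℝ → ℝ → ℝ} (hf : ∀ t x : ℝ, f t (x + 1) = f t x) (t x : ℝ) :
    pdt f t (x + 1) = pdt f t x := by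
  simp only [pdt, hf]

/-- A density whose time derivative is the space derivative of a periodic flux has constant
integral over a period. -/
theorem integral_eq_of_conservation_law {G F G' : ℝ → ℝ → ℝ} {t : ℝ} (ht : 0 ≤ t)
    (hG' : Continuous (Function.uncurry G')) (hGc : ∀ s, Continuous (G s))
    (hG : ∀ s x, HasDerivAt (fun r => G r x) (G' s x) s)
    (hF : ∀ s ∈ Icc 0 t, ∀ x, HasDerivAt (F s) (G' s x) x)
    (hper : ∀ s, F s 1 = F s 0) :
    ∫ x in (0:ℝ)..1, G t x = ∫ x in (0:ℝ)..1, G 0 x := by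
  have htime (x : ℝ) : ∫ s in (0:ℝ)..t, G' s x = G t x - G 0 x :=
    integral_eq_sub_of_hasDerivAt (fun s _ => hG s x)
      ((hG'.comp (Continuous.prodMk_left x)).intervalIntegrable _ _)
  have hspace : ∀ s ∈ uIcc 0 t, ∫ x in (0:ℝ)..1, G' s x = 0 := by
    intro s hs
    rw [uIcc_of_le ht] at hs
    rw [integral_eq_sub_of_hasDerivAt (fun x _ => hF s hs x)
      ((hG'.comp (Continuous.prodMk_right s)).intervalIntegrable _ _), hper, sub_self]
  have hint : IntegrableOn (Function.uncurry G') (uIoc 0 t ×ˢ uIoc 0 1) :=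
    (hG'.continuousOn.integrableOn_compact (isCompact_uIcc.prod isCompact_uIcc)).mono_set
      (prod_mono uIoc_subset_uIcc uIoc_subset_uIcc)
  rw [← sub_eq_zero, ← intervalIntegral.integral_sub ((hGc t).intervalIntegrable _ _)
    ((hGc 0).intervalIntegrable _ _)]
  simp_rw [← htime]
  rw [← intervalIntegral_intervalIntegral_swap, intervalIntegral.integral_congr hspace]
  · simp
  · exact hint

theorem hunter_saxton_conserved_quantity (T : EReal) (hT : 0 < T) (k : ℝ) (hk : k = 1 ∨ k = -1)
    (u ρ : ℝ → ℝ → ℝ)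
    (hu : ContDiff ℝ (⊤ : ℕ∞) (Function.uncurry u)) (hρ : ContDiff ℝ (⊤ : ℕ∞) (Function.uncurry ρ))
    (huper : ∀ t x : ℝ, u t (x + 1) = u t x) (hρper : ∀ t x : ℝ, ρ t (x + 1) = ρ t x)
    (heq1 : ∀ t x : ℝ, 0 ≤ t → (t : EReal) < T →
      pdt (pdx (pdx u)) t x + 2 * pdx u t x * pdx (pdx u) t x
        + u t x * pdx (pdx (pdx u)) t x - k * ρ t x * pdx ρ t x = 0)
    (heq2 : ∀ t x : ℝ, 0 ≤ t → (t : EReal) < T →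
      pdt ρ t x + pdx (fun s y => ρ s y * u s y) t x = 0) :
    ∀ t : ℝ, 0 ≤ t → (t : EReal) < T →
      ∫ x in (0:ℝ)..1, (k * (ρ t x) ^ 2 + (pdx u t x) ^ 2)
        = ∫ x in (0:ℝ)..1, (k * (ρ 0 x) ^ 2 + (pdx u 0 x) ^ 2) := by
  intro t ht htT
  have hux := contDiff_pdx hu
  have huxx := contDiff_pdx hux
  have huxt := contDiff_pdt hux
  have hρt := contDiff_pdt hρ
  refine integral_eq_of_conservation_law
    (G := fun s x => k * (ρ s x) ^ 2 + (pdx u s x) ^ 2)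
    (G' := fun s x => 2 * (k * ρ s x * pdt ρ s x + pdx u s x * pdt (pdx u) s x))
    (F := fun s x => 2 * (u s x * pdt (pdx u) s x + u s x ^ 2 * pdx (pdx u) s x
      - k * (ρ s x ^ 2 * u s x))) ht ?_ ?_ ?_ ?_ ?_
  · have h1 := hρ.continuous
    have h2 := hρt.continuous
    have h3 := hux.continuous
    have h4 := huxt.continuous
    simp only [Function.uncurry_def] at *
    fun_prop
  · intro s
    have h1 : Continuous (ρ s) := hρ.continuous.comp (Continuous.prodMk_right s)
    have h2 : Continuous (pdx u s) := hux.continuous.comp (Continuous.prodMk_right s)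
    fun_prop
  · intro s x
    convert! (((hasDerivAt_pdt hρ s x).pow 2).const_mul k).add ((hasDerivAt_pdt hux s x).pow 2)
      using 1
    push_cast
    ring
  · intro s hs x
    have hsT : (s : EReal) < T := (EReal.coe_le_coe_iff.mpr hs.2).trans_lt htT
    have e1 := heq1 s x hs.1 hsT
    have e2 := heq2 s x hs.1 hsT
    have hρu : pdx (fun s y => ρ s y * u s y) s x = pdx ρ s x * u s x + ρ s x * pdx u s x :=
      ((hasDerivAt_pdx hρ s x).mul (hasDerivAt_pdx hu s x)).deriv
    rw [hρu] at e2
    have du := hasDerivAt_pdx hu s x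
    convert! (((du.mul (hasDerivAt_pdx huxt s x)).add
      ((du.pow 2).mul (hasDerivAt_pdx huxx s x))).sub
      ((((hasDerivAt_pdx hρ s x).pow 2).mul du).const_mul k)).const_mul 2 using 1
    rw [pdx_pdt_comm hux]
    simp only [Pi.pow_apply]
    push_cast
    linear_combination 2 * k * ρ s x * e2 - 2 * u s x * e1
  · intro s
    have h1 := huper s 0
    have h2 := pdt_periodic (pdx_periodic huper) s 0
    have h3 := pdx_periodic (pdx_periodic huper) s 0
    have h4 := hρper s 0
    rw [zero_add] at h1 h2 h3 h4
    simp only [h1, h2, h3, h4]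
end

section
/- Let 0 < T ≤ ∞, let u : [0,T) × ℝ → ℝ be continuous with ∂_x u continuous on [0,T) × ℝ and u(t, x+1) = u(t,x) for all t, x, and let ρ : [0,T) × ℝ → ℝ be continuously differentiable, 1-periodic in x, and satisfy ρ_t + (ρ u)_x = 0 pointwise. If there exists M₁ > 0 such that u_x(t,x) ≥ −M₁ for all (t,x) ∈ [0,T) × ℝ, then for every t ∈ [0,T), sup_{x ∈ ℝ} |ρ(t,x)| ≤ e^{M₁ t} · sup_{x ∈ ℝ} |ρ(0,x)|. -/
open Real Set MeasureTheory intervalIntegral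

/-- If `f` has a maximum over `[0, b]` at a positive time `t`, its derivative at `t` is nonnegative. -/
theorem deriv_nonneg_of_isMaxOn_Icc {f : ℝ → ℝ} {f' t b : ℝ} (ht : t ∈ Icc 0 b) (ht0 : 0 < t)
    (hmax : IsMaxOn f (Icc 0 b) t) (hf : HasDerivAt f f' t) : 0 ≤ f' := by
  have hseg : segment ℝ t 0 ⊆ Icc 0 b :=
    (convex_Icc 0 b).segment_subset ht ⟨le_rfl, ht.1.trans ht.2⟩
  have h := hmax.localize.hasFDerivWithinAt_nonpos hf.hasFDerivAt.hasFDerivWithinAt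
    (sub_mem_posTangentConeAt_of_segment_subset hseg)
  simp at h
  nlinarith

/-- The product rule for `deriv` holds without differentiability of the second factor
at a critical point of the first factor where that factor does not vanish. -/
theorem deriv_mul_of_hasDerivAt_zero {f g : ℝ → ℝ} {x : ℝ} (hf : HasDerivAt f 0 x)
    (hx : f x ≠ 0) : deriv (fun y => f y * g y) x = f x * deriv g x := by
  by_cases hg : DifferentiableAt ℝ g x
  · simpa [Pi.mul_def] using (hf.mul hg.hasDerivAt).deriv
  · have hfg : ¬ DifferentiableAt ℝ (fun y => f y * g y) x := by
      intro h
      refine hg ((h.div hf.differentiableAt hx).congr_of_eventuallyEq ?_)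
      filter_upwards [hf.continuousAt.eventually_ne hx] with y hy
      simp [hy]
    rw [deriv_zero_of_not_differentiableAt hfg, deriv_zero_of_not_differentiableAt hg, mul_zero]

/-- A continuous function that is 1-periodic in space attains its maximum over `[0, b] × ℝ`. -/
theorem exists_forall_le_of_continuous_of_periodic {F : ℝ → ℝ → ℝ}
    (hF : Continuous (Function.uncurry F)) (hper : ∀ t x, F t (x + 1) = F t x)
    {b : ℝ} (hb : 0 ≤ b) :
    ∃ t ∈ Icc 0 b, ∃ x, ∀ s ∈ Icc 0 b, ∀ y, F s y ≤ F t x := by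
  obtain ⟨⟨t, x⟩, hmem, hmax⟩ := (isCompact_Icc.prod isCompact_Icc).exists_isMaxOn
    (s := Icc 0 b ×ˢ Icc (0 : ℝ) 1) ⟨(0, 0), by simp [hb]⟩ hF.continuousOn
  refine ⟨t, hmem.1, x, fun s hs y => ?_⟩
  obtain ⟨z, hz, hyz⟩ := Function.Periodic.exists_mem_Ico₀ (hper s) one_pos y
  rw [hyz]
  exact hmax (a := (s, z)) ⟨hs, Ico_subset_Icc_self hz⟩

theorem hunter_saxton_density_sup_bound (T : EReal) (hT : 0 < T)
    (u ρ : ℝ → ℝ → ℝ)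
    (hu : Continuous (Function.uncurry u))
    (hux : Continuous (Function.uncurry (pdx u)))
    (huper : ∀ t x : ℝ, u t (x + 1) = u t x)
    (hρ : ContDiff ℝ 1 (Function.uncurry ρ))
    (hρper : ∀ t x : ℝ, ρ t (x + 1) = ρ t x)
    (heq : ∀ t x : ℝ, 0 ≤ t → (t : EReal) < T →
      pdt ρ t x + pdx (fun s y => ρ s y * u s y) t x = 0)
    (M₁ : ℝ) (hM₁ : 0 < M₁)
    (hlb : ∀ t x : ℝ, 0 ≤ t → (t : EReal) < T → pdx u t x ≥ -M₁) :
    ∀ t : ℝ, 0 ≤ t → (t : EReal) < T →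
      ∀ x, |ρ t x| ≤ Real.exp (M₁ * t) * ⨆ y, |ρ 0 y| := by
  intro t₁ ht₁ ht₁T x₁
  have hdiff : Differentiable ℝ (Function.uncurry ρ) := hρ.differentiable one_ne_zero
  have hdt : ∀ t x, HasDerivAt (fun s => ρ s x) (pdt ρ t x) t := fun t x =>
    (DifferentiableAt.comp (f := fun s => (s, x)) t (hdiff (t, x)) (by fun_prop)).hasDerivAt
  have hdx : ∀ t x, DifferentiableAt ℝ (ρ t) x := fun t x =>
    DifferentiableAt.comp (f := fun y => (t, y)) x (hdiff (t, x)) (by fun_prop)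
  have hbdd : BddAbove (range fun y => |ρ 0 y|) :=
    (Function.Periodic.compact_of_continuous (fun y => by simp only [hρper 0 y]) one_ne_zero
      (continuous_iff_continuousAt.2 fun y => (hdx 0 y).continuousAt.abs)).bddAbove
  set S := ⨆ y, |ρ 0 y|
  have hle : ∀ y, |ρ 0 y| ≤ S := le_ciSup hbdd
  have hS : 0 ≤ S := (abs_nonneg _).trans (hle 0)
  have hweighted : ∀ ε > 0, ρ t₁ x₁ ^ 2 * exp (-(2 * M₁) * t₁) - ε * t₁ ≤ S ^ 2 := by
    intro ε hε
    obtain ⟨t, ht, x, hmax⟩ := exists_forall_le_of_continuous_of_periodic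
      (F := fun t x => ρ t x ^ 2 * exp (-(2 * M₁) * t) - ε * t)
      (by
        have : Continuous fun p : ℝ × ℝ => ρ p.1 p.2 := hρ.continuous
        change Continuous fun p : ℝ × ℝ =>
          ρ p.1 p.2 ^ 2 * exp (-(2 * M₁) * p.1) - ε * p.1
        fun_prop)
      (fun t x => by simp only [hρper]) ht₁
    refine (hmax t₁ ⟨ht₁, le_rfl⟩ x₁).trans ?_
    rcases ht.1.eq_or_lt with rfl | htpos
    · simpa using sq_le_sq' (abs_le.1 (hle x)).1 (abs_le.1 (hle x)).2
    · exfalso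
      have htT : (t : EReal) < T := (EReal.coe_le_coe_iff.2 ht.2).trans_lt ht₁T
      have hexp : HasDerivAt (fun s => exp (-(2 * M₁) * s))
          (exp (-(2 * M₁) * t) * (-(2 * M₁))) t := by
        simpa using ((hasDerivAt_id t).const_mul (-(2 * M₁))).exp
      have htime := deriv_nonneg_of_isMaxOn_Icc ht htpos (fun s hs => hmax s hs x)
        ((((hdt t x).pow 2).mul hexp).sub ((hasDerivAt_id t).const_mul ε))
      have hspace : IsLocalMax (fun y => ρ t y ^ 2) x := Filter.Eventually.of_forall fun y => by
        have := hmax t ht y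
        exact le_of_mul_le_mul_right (by linarith) (exp_pos (-(2 * M₁) * t))
      have hcrit := hspace.hasDerivAt_eq_zero ((hdx t x).hasDerivAt.pow 2)
      have hgrowth : ρ t x * pdt ρ t x ≤ M₁ * ρ t x ^ 2 := by
        by_cases h0 : ρ t x = 0
        · simp [h0]
        · have hx0 : HasDerivAt (ρ t) 0 x := by
            have : deriv (ρ t) x = 0 := by simpa [h0] using hcrit
            simpa [this] using (hdx t x).hasDerivAt
          have hprod : pdx (fun s y => ρ s y * u s y) t x = ρ t x * pdx u t x :=
            deriv_mul_of_hasDerivAt_zero hx0 h0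
          have hpde := heq t x ht.1 htT
          rw [hprod] at hpde
          rw [eq_neg_of_add_eq_zero_left hpde]
          nlinarith [hlb t x ht.1 htT, sq_nonneg (ρ t x)]
      have hE := exp_pos (-(2 * M₁) * t)
      simp at htime hE
      nlinarith
  have hsq : ρ t₁ x₁ ^ 2 * exp (-(2 * M₁) * t₁) ≤ S ^ 2 := by
    refine le_of_forall_pos_le_add fun ε hε => ?_
    have h := hweighted (ε / (t₁ + 1)) (by positivity)
    have : ε / (t₁ + 1) * t₁ ≤ ε := by
      rw [div_mul_eq_mul_div, div_le_iff₀ (by positivity)]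
      nlinarith
    linarith
  refine abs_le_of_sq_le_sq ?_ (by positivity)
  have hexp : exp (-(2 * M₁) * t₁) * exp (M₁ * t₁) ^ 2 = 1 := by
    rw [← exp_nat_mul, ← exp_add]
    simp
    ring
  calc ρ t₁ x₁ ^ 2 = ρ t₁ x₁ ^ 2 * exp (-(2 * M₁) * t₁) * exp (M₁ * t₁) ^ 2 := by
        rw [mul_assoc, hexp, mul_one]
    _ ≤ S ^ 2 * exp (M₁ * t₁) ^ 2 := by gcongr
    _ = (exp (M₁ * t₁) * S) ^ 2 := by ring
end

section
/- Let a > 0, let 0 < T ≤ ∞, and let m : [0,T) → ℝ be differentiable with m'(t) ≤ −(1/2)·m(t)² + a for all t ∈ [0,T). If m(0) < −√(2a), then m(t) < −√(2a) for all t ∈ [0,T), T is finite, and T ≤ (1/√(2a)) · ln( (m(0) − √(2a)) / (m(0) + √(2a)) ). -/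
open Real Set

/-- A function on `[0, b]` whose derivative satisfies `f' ≤ -f² / 2 + k² / 2` and which starts below
`-k` stays below its initial value. -/
lemma le_initial_of_riccati {k b : ℝ} (hk : 0 < k) {f f' : ℝ → ℝ}
    (hf : ContinuousOn f (Icc 0 b))
    (hf' : ∀ x ∈ Ico 0 b, HasDerivWithinAt f (f' x) (Ici x) x)
    (hineq : ∀ x ∈ Ico 0 b, f' x ≤ -(1 / 2) * f x ^ 2 + k ^ 2 / 2)
    (h0 : f 0 < -k) {x : ℝ} (hx : x ∈ Icc 0 b) : f x ≤ f 0 := by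
  refine image_le_of_deriv_right_lt_deriv_boundary (B := fun _ => f 0) (B' := fun _ => 0)
    hf hf' le_rfl (fun y => hasDerivAt_const y (f 0)) (fun y hy hfy => ?_) hx
  have h := hineq y hy
  rw [hfy] at h
  nlinarith

/-- The logarithm of the quotient `(f - k) / (f + k)`, split as a difference, decreases at rate at
least `k`. -/
lemma log_sub_log_le_of_riccati {k b : ℝ} (hk : 0 < k) {f f' : ℝ → ℝ}
    (hf : ContinuousOn f (Icc 0 b))
    (hf' : ∀ x ∈ Ico 0 b, HasDerivWithinAt f (f' x) (Ici x) x)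
    (hineq : ∀ x ∈ Ico 0 b, f' x ≤ -(1 / 2) * f x ^ 2 + k ^ 2 / 2)
    (h0 : f 0 < -k) {x : ℝ} (hx : x ∈ Icc 0 b) :
    log (k - f x) - log (-k - f x) ≤ log (k - f 0) - log (-k - f 0) - k * x := by
  have hlt : ∀ y ∈ Icc 0 b, f y < -k := fun y hy =>
    (le_initial_of_riccati hk hf hf' hineq h0 hy).trans_lt h0
  refine image_le_of_deriv_right_le_deriv_boundary
    (f := fun y => log (k - f y) - log (-k - f y))
    (f' := fun y => -f' y / (k - f y) - -f' y / (-k - f y))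
    (B := fun y => log (k - f 0) - log (-k - f 0) - k * y) (B' := fun _ => -k)
    ?_ (fun y hy => ?_) (by simp) (by fun_prop) (fun y _ => ?_) (fun y hy => ?_) hx
  · refine ((continuousOn_const.sub hf).log fun y hy => ?_).sub
      ((continuousOn_const.sub hf).log fun y hy => ?_)
    · exact (sub_pos.2 (by linarith [hlt y hy])).ne'
    · exact (sub_pos.2 (by linarith [hlt y hy])).ne'
  · have h := hlt y (Ico_subset_Icc_self hy)
    exact (((hf' y hy).const_sub k).log (by linarith)).sub
      (((hf' y hy).const_sub (-k)).log (by linarith))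
  · simpa using (((hasDerivAt_id y).const_mul k).const_sub
      (log (k - f 0) - log (-k - f 0))).hasDerivWithinAt
  · have h := hlt y (Ico_subset_Icc_self hy)
    have h₁ : 0 < k - f y := by linarith
    have h₂ : 0 < -k - f y := by linarith
    have heq : -f' y / (k - f y) - -f' y / (-k - f y)
        = 2 * k * f' y / ((k - f y) * (-k - f y)) := by
      field_simp
      ring
    rw [heq, div_le_iff₀ (mul_pos h₁ h₂)]
    nlinarith [mul_le_mul_of_nonneg_left (hineq y hy) hk.le]

/-- An interval on which `f' ≤ -f² / 2 + k² / 2` with `f 0 < -k` is shorter than the blow-up time. -/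
lemma lt_blowup_time_of_riccati {k b : ℝ} (hk : 0 < k) (hb : 0 ≤ b) {f f' : ℝ → ℝ}
    (hf : ContinuousOn f (Icc 0 b))
    (hf' : ∀ x ∈ Ico 0 b, HasDerivWithinAt f (f' x) (Ici x) x)
    (hineq : ∀ x ∈ Ico 0 b, f' x ≤ -(1 / 2) * f x ^ 2 + k ^ 2 / 2)
    (h0 : f 0 < -k) : b < 1 / k * log ((f 0 - k) / (f 0 + k)) := by
  have hmem : b ∈ Icc 0 b := right_mem_Icc.2 hb
  have hle := log_sub_log_le_of_riccati hk hf hf' hineq h0 hmem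
  have hfb := (le_initial_of_riccati hk hf hf' hineq h0 hmem).trans_lt h0
  have hlog : log (-k - f b) < log (k - f b) := log_lt_log (by linarith) (by linarith)
  have hquot : (f 0 - k) / (f 0 + k) = (k - f 0) / (-k - f 0) := by
    rw [← neg_div_neg_eq]
    congr 1 <;> ring
  rw [hquot, log_div (by linarith) (by linarith), one_div_mul_eq_div, lt_div_iff₀ hk]
  linarith

theorem riccati_blowup_pos_a (a : ℝ) (ha : 0 < a) (T : EReal) (hT : 0 < T)
    (m m' : ℝ → ℝ)
    (hderiv : ∀ t : ℝ, 0 ≤ t → (t : EReal) < T →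
      HasDerivWithinAt m (m' t) {s : ℝ | 0 ≤ s ∧ (s : EReal) < T} t)
    (hineq : ∀ t : ℝ, 0 ≤ t → (t : EReal) < T → m' t ≤ -(1 / 2) * (m t) ^ 2 + a)
    (h0 : m 0 < -Real.sqrt (2 * a)) :
    (∀ t : ℝ, 0 ≤ t → (t : EReal) < T → m t < -Real.sqrt (2 * a)) ∧
    T ≠ ⊤ ∧
    T ≤ ((1 / Real.sqrt (2 * a) *
        Real.log ((m 0 - Real.sqrt (2 * a)) / (m 0 + Real.sqrt (2 * a))) : ℝ) : EReal) := by
  have hk : 0 < √(2 * a) := sqrt_pos.2 (by linarith)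
  have hsq : √(2 * a) ^ 2 / 2 = a := by
    rw [sq_sqrt (by linarith)]
    ring
  have hlt : ∀ {x t : ℝ}, x ≤ t → (t : EReal) < T → (x : EReal) < T := fun hxt ht =>
    (EReal.coe_le_coe_iff.2 hxt).trans_lt ht
  have hcont : ∀ t : ℝ, (t : EReal) < T → ContinuousOn m (Icc 0 t) := fun t ht x hx =>
    (hderiv x hx.1 (hlt hx.2 ht)).continuousWithinAt.mono fun y hy => ⟨hy.1, hlt hy.2 ht⟩
  have hright : ∀ t : ℝ, (t : EReal) < T →
      ∀ x ∈ Ico 0 t, HasDerivWithinAt m (m' x) (Ici x) x := fun t ht x hx =>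
    (hderiv x hx.1 (hlt hx.2.le ht)).mono_of_mem_nhdsWithin <|
      Filter.mem_of_superset (Icc_mem_nhdsGE hx.2) fun y hy =>
        ⟨hx.1.trans hy.1, hlt hy.2 ht⟩
  have hineq' : ∀ t : ℝ, (t : EReal) < T →
      ∀ x ∈ Ico 0 t, m' x ≤ -(1 / 2) * m x ^ 2 + √(2 * a) ^ 2 / 2 := fun t ht x hx => by
    rw [hsq]
    exact hineq x hx.1 (hlt hx.2.le ht)
  have htime : ∀ t : ℝ, 0 ≤ t → (t : EReal) < T →
      t < 1 / √(2 * a) * log ((m 0 - √(2 * a)) / (m 0 + √(2 * a))) := fun t ht htT =>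
    lt_blowup_time_of_riccati hk ht (hcont t htT) (hright t htT) (hineq' t htT) h0
  have hbound : T ≤ ((1 / √(2 * a) *
      log ((m 0 - √(2 * a)) / (m 0 + √(2 * a))) : ℝ) : EReal) :=
    not_lt.1 fun h => lt_irrefl _ (htime _ (htime 0 le_rfl (by simpa using hT)).le h)
  refine ⟨fun t ht htT => ?_, (hbound.trans_lt (EReal.coe_lt_top _)).ne, hbound⟩
  exact (le_initial_of_riccati hk (hcont t htT) (hright t htT) (hineq' t htT) h0
    (right_mem_Icc.2 ht)).trans_lt h0
end

section
/- Let a ∈ ℝ, let 0 < T ≤ ∞, and let M, α : [0,T) → ℝ be differentiable functions satisfying M'(t) = −(1/2)·M(t)² + (1/2)·α(t)² + a and α'(t) = −α(t)·M(t) for all t ∈ [0,T), with α(0) ≠ 0. Then α(t) ≠ 0 and α(t)·α(0) > 0 for all t ∈ [0,T), and the Lyapunov function w(t) = α(t)·α(0) + (α(0)/α(t))·(1 + M(t)²) satisfies w'(t) = (α(0)/α(t))·M(t)·(2a + 1), w(t) ≤ w(0)·e^{|1+2a| t}, and consequently M(t) ≥ −( (α(0)² + 1 + M(0)²) / (2·|α(0)|)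 )·e^{|1+2a| t} for all t ∈ [0,T). -/
open Real Set

/-- A solution of the linear equation `α' = -α M` on `[0, t]` with continuous coefficient `M`
which starts at a nonzero value keeps its sign. -/
lemma mul_initial_pos_of_hasDerivWithinAt_neg_mul {M α : ℝ → ℝ} {t : ℝ} (ht : 0 ≤ t)
    (hM : ContinuousOn M (Icc 0 t))
    (hα : ∀ s ∈ Icc 0 t, HasDerivWithinAt α (-(α s * M s)) (Icc 0 t) s)
    (hα0 : α 0 ≠ 0) : ∀ s ∈ Icc 0 t, 0 < α s * α 0 := by
  have hαc : ContinuousOn α (Icc 0 t) := fun s hs => (hα s hs).continuousWithinAt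
  obtain ⟨K, hK⟩ := isCompact_Icc.exists_bound_of_continuousOn hM
  have hexp : ∀ s, HasDerivAt (fun s => exp (2 * K * s)) (exp (2 * K * s) * (2 * K)) s :=
    fun s => by simpa using ((hasDerivAt_id s).const_mul (2 * K)).exp
  have hmono : MonotoneOn (fun s => α s ^ 2 * exp (2 * K * s)) (Icc 0 t) := by
    refine monotoneOn_of_hasDerivWithinAt_nonneg (convex_Icc 0 t)
      (f' := fun s => 2 * (K - M s) * (α s ^ 2 * exp (2 * K * s))) (by fun_prop) ?_ ?_
    · intro s hs
      have hd := (((hα s (interior_subset hs)).pow 2).mul (hexp s).hasDerivWithinAt).mono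
        (interior_subset (s := Icc (0 : ℝ) t))
      refine hd.congr_deriv ?_
      simp
      ring
    · intro s hs
      have h := (abs_le.1 (hK s (interior_subset hs))).2
      have : 0 ≤ K - M s := by linarith
      positivity
  have hne : ∀ s ∈ Icc 0 t, α s ≠ 0 := by
    intro s hs h0
    have h := hmono ⟨le_rfl, ht⟩ hs hs.1
    have hpos : 0 < α 0 ^ 2 := by positivity
    simp [h0] at h
    exact hα0 h
  intro s hs
  by_contra! hneg
  have hsub : Icc 0 s ⊆ Icc 0 t := Icc_subset_Icc le_rfl hs.2
  have hc : ContinuousOn (fun r => α r * α 0) (Icc 0 s) :=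
    (hαc.mono hsub).mul continuousOn_const
  obtain ⟨r, hr, hr0⟩ := intermediate_value_Icc' hs.1 hc ⟨hneg, mul_self_nonneg (α 0)⟩
  exact (mul_ne_zero (hne r (hsub hr)) hα0) hr0

/-- A scalar differential inequality `w' ≤ c w` on `[0, t]` gives exponential growth at most. -/
lemma le_mul_exp_of_hasDerivWithinAt_le {w w' : ℝ → ℝ} {c t : ℝ} (ht : 0 ≤ t)
    (hw : ∀ s ∈ Icc 0 t, HasDerivWithinAt w (w' s) (Icc 0 t) s)
    (hle : ∀ s ∈ Icc 0 t, w' s ≤ c * w s) : w t ≤ w 0 * exp (c * t) := by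
  have hwc : ContinuousOn w (Icc 0 t) := fun s hs => (hw s hs).continuousWithinAt
  have hexp : ∀ s, HasDerivAt (fun s => exp (-(c * s))) (exp (-(c * s)) * (-c)) s :=
    fun s => by simpa using ((hasDerivAt_id s).const_mul c).neg.exp
  have hanti : AntitoneOn (fun s => w s * exp (-(c * s))) (Icc 0 t) := by
    refine antitoneOn_of_hasDerivWithinAt_nonpos (convex_Icc 0 t)
      (f' := fun s => (w' s - c * w s) * exp (-(c * s))) (by fun_prop) ?_ ?_
    · intro s hs
      have hd := ((hw s (interior_subset hs)).mul (hexp s).hasDerivWithinAt).mono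
        (interior_subset (s := Icc (0 : ℝ) t))
      refine hd.congr_deriv ?_
      ring
    · intro s hs
      exact mul_nonpos_of_nonpos_of_nonneg
        (sub_nonpos.2 (hle s (interior_subset hs))) (exp_pos _).le
  have h := hanti ⟨le_rfl, ht⟩ ⟨ht, le_rfl⟩ ht
  simp only [mul_zero, neg_zero, exp_zero, mul_one, exp_neg] at h
  rwa [← div_eq_mul_inv, div_le_iff₀ (exp_pos _)] at h

theorem ode_system_lyapunov_lower_bound (a : ℝ) (T : EReal) (hT : 0 < T)
    (M α : ℝ → ℝ)
    (hM : ∀ t : ℝ, 0 ≤ t → (t : EReal) < T →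
      HasDerivWithinAt M (-(1 / 2) * (M t) ^ 2 + (1 / 2) * (α t) ^ 2 + a)
        {s : ℝ | 0 ≤ s ∧ (s : EReal) < T} t)
    (hα : ∀ t : ℝ, 0 ≤ t → (t : EReal) < T →
      HasDerivWithinAt α (-(α t * M t)) {s : ℝ | 0 ≤ s ∧ (s : EReal) < T} t)
    (hα0 : α 0 ≠ 0) :
    ∀ t : ℝ, 0 ≤ t → (t : EReal) < T →
      α t ≠ 0 ∧ 0 < α t * α 0 ∧
      HasDerivWithinAt (fun s => α s * α 0 + (α 0 / α s) * (1 + (M s) ^ 2))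
        ((α 0 / α t) * M t * (2 * a + 1)) {s : ℝ | 0 ≤ s ∧ (s : EReal) < T} t ∧
      α t * α 0 + (α 0 / α t) * (1 + (M t) ^ 2) ≤
        ((α 0) ^ 2 + 1 + (M 0) ^ 2) * Real.exp (|1 + 2 * a| * t) ∧
      M t ≥ -(((α 0) ^ 2 + 1 + (M 0) ^ 2) / (2 * |α 0|)) * Real.exp (|1 + 2 * a| * t) := by
  have hsub : ∀ t : ℝ, (t : EReal) < T → Icc 0 t ⊆ {s : ℝ | 0 ≤ s ∧ (s : EReal) < T} :=
    fun t htT s hs => ⟨hs.1, lt_of_le_of_lt (EReal.coe_le_coe_iff.2 hs.2) htT⟩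
  have hpos : ∀ t : ℝ, 0 ≤ t → (t : EReal) < T → 0 < α t * α 0 := by
    intro t ht htT
    have hs := hsub t htT
    exact mul_initial_pos_of_hasDerivWithinAt_neg_mul ht
      (fun s h => ((hM s (hs h).1 (hs h).2).mono hs).continuousWithinAt)
      (fun s h => (hα s (hs h).1 (hs h).2).mono hs) hα0 t ⟨ht, le_rfl⟩
  have hne : ∀ t : ℝ, 0 ≤ t → (t : EReal) < T → α t ≠ 0 :=
    fun t ht htT => left_ne_zero_of_mul (hpos t ht htT).ne'
  have hquot : ∀ t : ℝ, 0 ≤ t → (t : EReal) < T → 0 < α 0 / α t := by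
    intro t ht htT
    have hn := hne t ht htT
    have h : α 0 / α t = α t * α 0 / α t ^ 2 := by field_simp
    rw [h]
    exact div_pos (hpos t ht htT) (by positivity)
  have hderiv : ∀ t : ℝ, 0 ≤ t → (t : EReal) < T →
      HasDerivWithinAt (fun s => α s * α 0 + (α 0 / α s) * (1 + (M s) ^ 2))
        ((α 0 / α t) * M t * (2 * a + 1)) {s : ℝ | 0 ≤ s ∧ (s : EReal) < T} t := by
    intro t ht htT
    have hn := hne t ht htT
    have hd := ((hα t ht htT).mul_const (α 0)).add
      (((hasDerivWithinAt_const t _ (α 0)).div (hα t ht htT) hn).mul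
        (((hM t ht htT).pow 2).const_add 1))
    refine hd.congr_deriv ?_
    simp
    field_simp
    ring
  intro t ht htT
  have hs := hsub t htT
  have hbound : α t * α 0 + (α 0 / α t) * (1 + (M t) ^ 2) ≤
      ((α 0) ^ 2 + 1 + (M 0) ^ 2) * Real.exp (|1 + 2 * a| * t) := by
    have h := le_mul_exp_of_hasDerivWithinAt_le (c := |1 + 2 * a|) ht
      (fun s h => (hderiv s (hs h).1 (hs h).2).mono hs) (fun s h => by
        have hp := hpos s (hs h).1 (hs h).2
        have hq := hquot s (hs h).1 (hs h).2
        have hMs : |M s| ≤ 1 + M s ^ 2 := by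
          nlinarith [sq_abs (M s), sq_nonneg (|M s| - 1), abs_nonneg (M s)]
        calc α 0 / α s * M s * (2 * a + 1)
            ≤ |α 0 / α s * M s * (2 * a + 1)| := le_abs_self _
          _ = |1 + 2 * a| * (α 0 / α s * |M s|) := by
              rw [abs_mul, abs_mul, abs_of_pos hq, add_comm (2 * a)]
              ring
          _ ≤ |1 + 2 * a| * (α s * α 0 + α 0 / α s * (1 + M s ^ 2)) := by
              gcongr
              nlinarith [mul_le_mul_of_nonneg_left hMs hq.le])
    simpa [div_self hα0, sq, add_assoc] using h
  refine ⟨hne t ht htT, hpos t ht htT, hderiv t ht htT, hbound, ?_⟩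
  have hn := hne t ht htT
  have hq := hquot t ht htT
  have hlower : 2 * |α 0| * |M t| ≤ α t * α 0 + (α 0 / α t) * (1 + (M t) ^ 2) := by
    have h : α t * α 0 + α 0 / α t * (1 + M t ^ 2) - 2 * |α 0| * |M t| =
        α 0 / α t * ((|α t| - |M t|) ^ 2 + 1) := by
      have habs : |α 0| = α 0 / α t * |α t| := by
        rw [← abs_of_pos hq, ← abs_mul, div_mul_cancel₀ _ hn]
      have hmul : α t * α 0 = α 0 / α t * |α t| ^ 2 := by
        rw [sq_abs]
        field_simp
      rw [habs, hmul, ← sq_abs (M t)]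
      ring
    have : 0 ≤ α 0 / α t * ((|α t| - |M t|) ^ 2 + 1) := by positivity
    linarith
  have hα0' : 0 < 2 * |α 0| := by positivity
  have habsM : |M t| ≤
      ((α 0) ^ 2 + 1 + (M 0) ^ 2) / (2 * |α 0|) * Real.exp (|1 + 2 * a| * t) := by
    rw [div_mul_eq_mul_div, le_div_iff₀ hα0']
    linarith
  linarith [neg_abs_le (M t)]
end
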